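/- arXiv:math/0406495 — 2 statements merged into one kernel-verified Lean document; each statement's English description precedes it below -/
import Mathlib

section
/- Let a : ℝ → ℝ be a 2π-periodic measurable function with 0 < m ≤ a(θ) ≤ M for all θ and some constants m, M. Let w : ℝ → ℝ be 2π-periodic and locally absolutely continuous, with derivative w' square-integrable on [0,2π], and suppose ∫₀^{2π} a(θ) w(θ) dθ = 0. Then ∫₀^{2π} a(θ) w(θ)² dθ ≤ ((1/(2π)) ∫₀^{2π} a(θ) dθ)² · ∫₀^{2π} (1/a(θ)) w'(θ)² dθ. -/
open MeasureTheory Real Set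

noncomputable section

/-- `w` is locally absolutely continuous with (locally integrable) derivative `w'`. -/
def IsAbsCont (w w' : ℝ → ℝ) : Prop :=
  LocallyIntegrable w' volume ∧ ∀ θ : ℝ, w θ = w 0 + ∫ s in (0:ℝ)..θ, w' s

/-- `w` is `2π`-periodic, locally absolutely continuous with derivative `w'`,
and `w'` is square-integrable on `[0, 2π]`: the `2π`-periodic class in `H¹_loc(ℝ)`. -/
def MemH1Per (w w' : ℝ → ℝ) : Prop :=
  Function.Periodic w (2 * π) ∧ IsAbsCont w w' ∧
  IntegrableOn (fun θ => w' θ ^ 2) (Ioc 0 (2 * π)) volume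

theorem intervalIntegrable_of_measurable_of_bounds {a : ℝ → ℝ} (ha : Measurable a) {m M : ℝ}
    (hbd : ∀ x, m ≤ a x ∧ a x ≤ M) (s t : ℝ) : IntervalIntegrable a volume s t := by
  refine (intervalIntegrable_const (c := max |m| |M|)).mono_fun ha.aestronglyMeasurable ?_
  refine Filter.Eventually.of_forall fun x => ?_
  simp only [Real.norm_eq_abs]
  exact (abs_le_max_abs_abs (hbd x).1 (hbd x).2).trans (le_abs_self _)

/-- Picone-type inequality: a solution `g` of the Riccati equation `g' = ω a (1 + g²)` calibrates
the weighted Dirichlet energy of functions vanishing at the endpoints. -/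
theorem integral_weighted_sq_le_of_riccati {a u g : ℝ → ℝ} {α β ω : ℝ} (hαβ : α ≤ β)
    (hpos : ∀ x, 0 < a x) (ha : IntervalIntegrable a volume α β)
    (hu : AbsolutelyContinuousOnInterval u α β) (hg : AbsolutelyContinuousOnInterval g α β)
    (huα : u α = 0) (huβ : u β = 0)
    (hE : IntervalIntegrable (fun x => 1 / a x * deriv u x ^ 2) volume α β)
    (hric : ∀ᵐ x, x ∈ uIcc α β → HasDerivAt g (ω * a x * (1 + g x ^ 2)) x) :
    ω ^ 2 * ∫ x in α..β, a x * u x ^ 2 ≤ ∫ x in α..β, 1 / a x * deriv u x ^ 2 := by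
  have hF : AbsolutelyContinuousOnInterval (fun x => u x * u x * g x) α β :=
    (hu.fun_mul hu).fun_mul hg
  have hint : IntervalIntegrable (fun x => ω ^ 2 * (a x * u x ^ 2)) volume α β :=
    (ha.mul_continuousOn (hu.continuousOn.pow 2)).const_mul _
  have hint' := hE.add (hF.intervalIntegrable_deriv.const_mul ω)
  have hzero : ∫ x in α..β, deriv (fun x => u x * u x * g x) x = 0 := by
    rw [hF.integral_deriv_eq_sub, huα, huβ]
    ring
  have key : ∫ x in α..β, ω ^ 2 * (a x * u x ^ 2) ≤
      ∫ x in α..β, (1 / a x * deriv u x ^ 2 + ω * deriv (fun x => u x * u x * g x) x) := by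
    refine intervalIntegral.integral_mono_ae_restrict hαβ hint hint' ?_
    refine (ae_restrict_iff' measurableSet_Icc).2 ?_
    filter_upwards [hu.ae_differentiableAt, hric] with x hux hgx hx
    rw [← uIcc_of_le hαβ] at hx
    have hd := (((hux hx).hasDerivAt.fun_mul (hux hx).hasDerivAt).fun_mul (hgx hx)).deriv
    have hsq : 0 ≤ 1 / a x * (deriv u x + ω * a x * g x * u x) ^ 2 :=
      mul_nonneg (one_div_pos.2 (hpos x)).le (sq_nonneg _)
    rw [hd, ← sub_nonneg]
    have hne := (hpos x).ne'
    convert hsq using 1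
    field_simp
    ring
  rw [intervalIntegral.integral_const_mul, intervalIntegral.integral_add hE
    (hF.intervalIntegrable_deriv.const_mul ω), intervalIntegral.integral_const_mul, hzero] at key
  simpa using key

/-- The weighted Dirichlet inequality with a non-optimal constant. -/
theorem integral_weighted_sq_le_of_mul_lt_pi {a u : ℝ → ℝ} {α β ω m M : ℝ} (hαβ : α ≤ β)
    (hm : 0 < m) (hmeas : Measurable a) (hbd : ∀ x, m ≤ a x ∧ a x ≤ M)
    (hu : AbsolutelyContinuousOnInterval u α β) (huα : u α = 0) (huβ : u β = 0)
    (hE : IntervalIntegrable (fun x => 1 / a x * deriv u x ^ 2) volume α β)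
    (hω : 0 ≤ ω) (hωπ : ω * ∫ x in α..β, a x < π) :
    ω ^ 2 * ∫ x in α..β, a x * u x ^ 2 ≤ ∫ x in α..β, 1 / a x * deriv u x ^ 2 := by
  have hpos : ∀ x, 0 < a x := fun x => hm.trans_le (hbd x).1
  have hai := intervalIntegrable_of_measurable_of_bounds hmeas hbd
  set L := ∫ x in α..β, a x with hL
  set φ : ℝ → ℝ := fun x => ω * ((∫ t in α..x, a t) - L / 2) with hφ
  have hφ_mem : MapsTo φ (uIcc α β) (uIcc (-(ω * L / 2)) (ω * L / 2)) := by
    intro x hx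
    rw [uIcc_of_le hαβ] at hx
    have h1 : 0 ≤ ∫ t in α..x, a t :=
      intervalIntegral.integral_nonneg hx.1 fun t _ => (hpos t).le
    have h2 : 0 ≤ ∫ t in x..β, a t :=
      intervalIntegral.integral_nonneg hx.2 fun t _ => (hpos t).le
    have h3 := intervalIntegral.integral_add_adjacent_intervals (hai α x) (hai x β)
    rw [← hL] at h3
    have h4 := mul_nonneg hω h1
    have h5 := mul_nonneg hω h2
    have h6 : ω * (∫ t in α..x, a t) + ω * (∫ t in x..β, a t) = ω * L := by rw [← h3]; ring
    refine Icc_subset_uIcc ⟨?_, ?_⟩ <;> simp only [hφ] <;> linarith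
  have hL0 : 0 ≤ ω * L := mul_nonneg hω
    (intervalIntegral.integral_nonneg hαβ fun t _ => (hpos t).le)
  have hcos : ∀ y ∈ uIcc (-(ω * L / 2)) (ω * L / 2), cos y ≠ 0 := by
    intro y hy
    rw [uIcc_of_le (by linarith)] at hy
    exact (cos_pos_of_mem_Ioo ⟨by linarith [hy.1], by linarith [hy.2]⟩).ne'
  have htan : ContDiffOn ℝ 1 tan (uIcc (-(ω * L / 2)) (ω * L / 2)) := fun y hy =>
    (contDiffAt_tan.2 (hcos y hy)).contDiffWithinAt
  obtain ⟨K, hK⟩ := htan.exists_lipschitzOnWith (by decide) (convex_Icc _ _) isCompact_Icc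
  have hφ_lip : LipschitzWith (Real.toNNReal (ω * M)) φ := by
    refine LipschitzWith.of_dist_le_mul fun x y => ?_
    have hM : 0 ≤ M := hm.le.trans ((hbd 0).1.trans (hbd 0).2)
    have h1 : φ x - φ y = ω * ∫ t in y..x, a t := by
      rw [← intervalIntegral.integral_interval_sub_left (hai α x) (hai α y)]
      simp only [hφ]
      ring
    have h2 : ‖∫ t in y..x, a t‖ ≤ M * |x - y| :=
      intervalIntegral.norm_integral_le_of_norm_le_const fun t _ => by
        rw [Real.norm_of_nonneg (hpos t).le]
        exact (hbd t).2
    rw [Real.dist_eq, Real.dist_eq, h1, abs_mul, abs_of_nonneg hω,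
      Real.coe_toNNReal _ (mul_nonneg hω hM), mul_assoc]
    exact mul_le_mul_of_nonneg_left h2 hω
  have hg : AbsolutelyContinuousOnInterval (tan ∘ φ) α β :=
    (hK.comp (hφ_lip.lipschitzOnWith) hφ_mem).absolutelyContinuousOnInterval
  refine integral_weighted_sq_le_of_riccati hαβ hpos (hai α β) hu hg huα huβ hE ?_
  filter_upwards [(hai α β).ae_hasDerivAt_integral] with x hx hxm
  have hφ' : HasDerivAt φ (ω * a x) x :=
    ((hx hxm α left_mem_uIcc).sub_const (L / 2)).const_mul ω
  have hc := hcos _ (hφ_mem hxm)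
  refine ((hasDerivAt_tan hc).comp x hφ').congr_deriv ?_
  rw [Function.comp_apply, ← inv_one_add_tan_sq hc]
  simp
  ring

/-- The sharp weighted Dirichlet inequality on an interval. -/
theorem integral_weighted_sq_le_of_dirichlet {a u : ℝ → ℝ} {α β m M : ℝ} (hαβ : α < β)
    (hm : 0 < m) (hmeas : Measurable a) (hbd : ∀ x, m ≤ a x ∧ a x ≤ M)
    (hu : AbsolutelyContinuousOnInterval u α β) (huα : u α = 0) (huβ : u β = 0)
    (hE : IntervalIntegrable (fun x => 1 / a x * deriv u x ^ 2) volume α β) :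
    ∫ x in α..β, a x * u x ^ 2 ≤
      ((∫ x in α..β, a x) / π) ^ 2 * ∫ x in α..β, 1 / a x * deriv u x ^ 2 := by
  have hL : 0 < ∫ x in α..β, a x :=
    intervalIntegral.intervalIntegral_pos_of_pos
      (intervalIntegrable_of_measurable_of_bounds hmeas hbd α β)
      (fun x => hm.trans_le (hbd x).1) hαβ
  set L := ∫ x in α..β, a x
  have hlim : (π / L) ^ 2 * ∫ x in α..β, a x * u x ^ 2 ≤ ∫ x in α..β, 1 / a x * deriv u x ^ 2 := by
    have hcont : Filter.Tendsto (fun ω : ℝ => ω ^ 2 * ∫ x in α..β, a x * u x ^ 2)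
        (nhdsWithin (π / L) (Iio (π / L))) (nhds ((π / L) ^ 2 * ∫ x in α..β, a x * u x ^ 2)) :=
      ((continuous_pow 2).mul continuous_const).continuousAt.mono_left nhdsWithin_le_nhds
    refine le_of_tendsto hcont ?_
    filter_upwards [Ioo_mem_nhdsLT (div_pos pi_pos hL)] with ω hω
    exact integral_weighted_sq_le_of_mul_lt_pi hαβ.le hm hmeas hbd hu huα huβ hE hω.1.le
      ((lt_div_iff₀ hL).1 hω.2)
  calc ∫ x in α..β, a x * u x ^ 2
      = (L / π) ^ 2 * ((π / L) ^ 2 * ∫ x in α..β, a x * u x ^ 2) := by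
        have := pi_pos.ne'
        field_simp
    _ ≤ _ := mul_le_mul_of_nonneg_left hlim (sq_nonneg _)

/-- A continuous periodic function takes equal values at two points which split some period into
two pieces of equal mass. -/
theorem exists_eq_of_half_mass {a w : ℝ → ℝ} {T m M : ℝ} (hT : 0 < T) (hm : 0 < m)
    (hmeas : Measurable a) (hbd : ∀ x, m ≤ a x ∧ a x ≤ M) (haper : Function.Periodic a T)
    (hw : Continuous w) (hwper : Function.Periodic w T) :
    ∃ α β, α < β ∧ β < α + T ∧ w α = w β ∧
      ∫ x in α..β, a x = (∫ x in (0:ℝ)..T, a x) / 2 ∧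
      ∫ x in β..(α + T), a x = (∫ x in (0:ℝ)..T, a x) / 2 := by
  have hai := intervalIntegrable_of_measurable_of_bounds hmeas hbd
  have hpos : ∀ x, 0 < a x := fun x => hm.trans_le (hbd x).1
  set A := ∫ x in (0:ℝ)..T, a x with hA
  have hA0 : 0 < A := intervalIntegral.intervalIntegral_pos_of_pos (hai _ _) hpos hT
  set P : ℝ → ℝ := fun x => ∫ t in (0:ℝ)..x, a t with hP
  have hPsub (x y : ℝ) : ∫ t in x..y, a t = P y - P x :=
    (intervalIntegral.integral_interval_sub_left (hai 0 y) (hai 0 x)).symm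
  have hPmono : StrictMono P := fun x y hxy => by
    rw [← sub_pos, ← hPsub]
    exact intervalIntegral.intervalIntegral_pos_of_pos (hai _ _) hpos hxy
  have hPcont : Continuous P := intervalIntegral.continuous_primitive hai 0
  have hPT (x : ℝ) : P (x + T) = P x + A := by
    have := haper.intervalIntegral_add_eq x 0
    rw [zero_add, hPsub, ← hA] at this
    linarith
  have hPsurj : Function.Surjective P := hPcont.surjective
    (haper.tendsto_atTop_intervalIntegral_of_pos' (hai _ _) hpos hT)
    (haper.tendsto_atBot_intervalIntegral_of_pos' (hai _ _) hpos hT)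
  set Q := (hPmono.orderIsoOfSurjective P hPsurj).symm with hQ
  have hPQ (t : ℝ) : P (Q t) = t := (hPmono.orderIsoOfSurjective P hPsurj).apply_symm_apply t
  have hQcont : Continuous Q := Q.continuous
  have hQA (t : ℝ) : Q (t + A) = Q t + T := hPmono.injective (by rw [hPT, hPQ, hPQ])
  set D : ℝ → ℝ := fun t => w (Q (t + A / 2)) - w (Q t) with hD
  have hDcont : Continuous D := by fun_prop
  have hD_half : D (A / 2) = - D 0 := by
    have h1 : Q (A / 2 + A / 2) = Q 0 + T := by rw [← hQA, add_halves, zero_add]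
    simp only [hD, h1, hwper (Q 0), zero_add, neg_sub]
  obtain ⟨t, -, ht⟩ : (0:ℝ) ∈ D '' uIcc 0 (A / 2) := by
    refine intermediate_value_uIcc hDcont.continuousOn ?_
    rw [hD_half]
    rcases le_total (D 0) 0 with h | h
    · exact Icc_subset_uIcc ⟨h, by linarith⟩
    · exact Icc_subset_uIcc' ⟨by linarith, h⟩
  refine ⟨Q t, Q (t + A / 2), Q.strictMono (by linarith), ?_, (sub_eq_zero.1 ht).symm, ?_, ?_⟩
  · rw [← hQA]
    exact Q.strictMono (by linarith)
  · rw [hPsub, hPQ, hPQ]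
    ring
  · rw [hPsub, hPT, hPQ, hPQ]
    ring

theorem IsAbsCont.intervalIntegrable {w w' : ℝ → ℝ} (h : IsAbsCont w w') (s t : ℝ) :
    IntervalIntegrable w' volume s t :=
  intervalIntegrable_iff.2 <|
    (LocallyIntegrable.integrableOn_isCompact h.1 isCompact_uIcc).mono_set uIoc_subset_uIcc

theorem IsAbsCont.absolutelyContinuousOnInterval {w w' : ℝ → ℝ} (h : IsAbsCont w w') (s t : ℝ) :
    AbsolutelyContinuousOnInterval w s t := by
  have hw : w = fun θ => w 0 + ∫ s in (0:ℝ)..θ, w' s := funext h.2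
  have hI : AbsolutelyContinuousOnInterval (fun θ => ∫ s in (0:ℝ)..θ, w' s)
      (min s 0 ⊓ t) (max s 0 ⊔ t) := by
    refine IntervalIntegrable.absolutelyContinuousOnInterval_intervalIntegral
      (h.intervalIntegrable _ _) ?_
    exact Icc_subset_uIcc ⟨by simp, by simp⟩
  have hc : AbsolutelyContinuousOnInterval (fun _ : ℝ => w 0) s t :=
    contDiffOn_const.absolutelyContinuousOnInterval
  rw [hw]
  refine hc.fun_add (hI.mono ?_)
  refine uIcc_subset_uIcc (Icc_subset_uIcc ⟨?_, ?_⟩) (Icc_subset_uIcc ⟨?_, ?_⟩) <;> simp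

theorem IsAbsCont.ae_deriv_eq {w w' : ℝ → ℝ} (h : IsAbsCont w w') : deriv w =ᵐ[volume] w' := by
  filter_upwards [LocallyIntegrable.ae_hasDerivAt_integral h.1] with x hx
  rw [funext h.2]
  exact ((hx 0).const_add (w 0)).deriv

theorem IsAbsCont.continuous {w w' : ℝ → ℝ} (h : IsAbsCont w w') : Continuous w := by
  rw [funext h.2]
  exact continuous_const.add
    (intervalIntegral.continuous_primitive h.intervalIntegrable 0)

/-- **Sharp Wirtinger-type inequality.** -/
theorem sharp_wirtinger_inequality
    (a : ℝ → ℝ) (hameas : Measurable a) (haper : Function.Periodic a (2 * π))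
    (m M : ℝ) (hm : 0 < m) (hbd : ∀ θ : ℝ, m ≤ a θ ∧ a θ ≤ M)
    (w w' : ℝ → ℝ) (hw : MemH1Per w w')
    (hmean : ∫ θ in (0:ℝ)..(2 * π), a θ * w θ = 0) :
    ∫ θ in (0:ℝ)..(2 * π), a θ * w θ ^ 2 ≤
      (1 / (2 * π) * ∫ θ in (0:ℝ)..(2 * π), a θ) ^ 2 *
        ∫ θ in (0:ℝ)..(2 * π), 1 / a θ * w' θ ^ 2 := by
  obtain ⟨hwper, hac, hsq⟩ := hw
  have hai := intervalIntegrable_of_measurable_of_bounds hameas hbd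
  have hpos : ∀ x, 0 < a x := fun x => hm.trans_le (hbd x).1
  have hderiv : (fun θ => 1 / a θ * deriv w θ ^ 2) =ᵐ[volume] fun θ => 1 / a θ * w' θ ^ 2 := by
    filter_upwards [hac.ae_deriv_eq] with θ hθ
    rw [hθ]
  have hEper : Function.Periodic (fun θ => 1 / a θ * deriv w θ ^ 2) (2 * π) := by
    intro θ
    have : deriv w (θ + 2 * π) = deriv w θ := by
      rw [← deriv_comp_add_const, funext hwper]
    simp only [haper θ, this]
  have hEint (s t : ℝ) : IntervalIntegrable (fun θ => 1 / a θ * deriv w θ ^ 2) volume s t := by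
    refine hEper.intervalIntegrable₀ two_pi_pos.ne' ?_ s t
    refine IntervalIntegrable.congr_ae ?_ (ae_restrict_of_ae hderiv.symm)
    rw [intervalIntegrable_iff_integrableOn_Ioc_of_le two_pi_pos.le]
    refine Integrable.bdd_mul (c := 1 / m) hsq (measurable_const.div hameas).aestronglyMeasurable ?_
    refine Filter.Eventually.of_forall fun θ => ?_
    rw [Real.norm_of_nonneg (one_div_pos.2 (hpos θ)).le]
    exact one_div_le_one_div_of_le hm (hbd θ).1
  obtain ⟨α, β, hαβ, hβα, hwαβ, hmass, hmass'⟩ :=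
    exists_eq_of_half_mass two_pi_pos hm hameas hbd haper hac.continuous hwper
  set A := ∫ θ in (0:ℝ)..(2 * π), a θ with hA
  have hA0 : 0 ≤ A := intervalIntegral.integral_nonneg two_pi_pos.le fun θ _ => (hpos θ).le
  set k := w α with hk
  set u : ℝ → ℝ := fun θ => w θ - k with hu
  have hdu : deriv u = deriv w := funext fun θ => deriv_sub_const k
  have huac (s t : ℝ) : AbsolutelyContinuousOnInterval u s t := by
    have hc : AbsolutelyContinuousOnInterval (fun _ : ℝ => k) s t :=
      contDiffOn_const.absolutelyContinuousOnInterval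
    exact (hac.absolutelyContinuousOnInterval s t).fun_sub hc
  have hau (s t : ℝ) : IntervalIntegrable (fun θ => a θ * u θ ^ 2) volume s t :=
    (hai s t).mul_continuousOn ((hac.continuous.sub continuous_const).pow 2).continuousOn
  have hleft := integral_weighted_sq_le_of_dirichlet hαβ hm hameas hbd (huac α β)
    (by simp [hu, hk]) (by simp [hu, hwαβ]) (by rw [hdu]; exact hEint α β)
  have hright := integral_weighted_sq_le_of_dirichlet hβα hm hameas hbd (huac β (α + 2 * π))
    (by simp [hu, hwαβ]) (by simp [hu, hwper α, hk]) (by rw [hdu]; exact hEint _ _)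
  rw [hmass, hdu] at hleft
  rw [hmass', hdu] at hright
  have haper_u : Function.Periodic (fun θ => a θ * u θ ^ 2) (2 * π) := fun θ => by
    simp only [hu, haper θ, hwper θ]
  have hperiod : ∫ θ in (0:ℝ)..(2 * π), a θ * u θ ^ 2 ≤
      (A / 2 / π) ^ 2 * ∫ θ in (0:ℝ)..(2 * π), 1 / a θ * deriv w θ ^ 2 := by
    have h1 := haper_u.intervalIntegral_add_eq α 0
    have h2 := hEper.intervalIntegral_add_eq α 0
    rw [zero_add] at h1 h2
    rw [← h1, ← h2, ← intervalIntegral.integral_add_adjacent_intervals (hau α β) (hau β _),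
      ← intervalIntegral.integral_add_adjacent_intervals (hEint α β) (hEint β _), mul_add]
    exact add_le_add hleft hright
  have hexpand : ∫ θ in (0:ℝ)..(2 * π), a θ * u θ ^ 2 =
      (∫ θ in (0:ℝ)..(2 * π), a θ * w θ ^ 2) + k ^ 2 * A := by
    have i1 : IntervalIntegrable (fun θ => a θ * w θ ^ 2) volume 0 (2 * π) :=
      (hai _ _).mul_continuousOn (hac.continuous.pow 2).continuousOn
    have i2 : IntervalIntegrable (fun θ => (2 * k) * (a θ * w θ)) volume 0 (2 * π) :=
      ((hai _ _).mul_continuousOn hac.continuous.continuousOn).const_mul _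
    have i3 : IntervalIntegrable (fun θ => k ^ 2 * a θ) volume 0 (2 * π) := (hai _ _).const_mul _
    have he : (fun θ => a θ * u θ ^ 2) =
        fun θ => a θ * w θ ^ 2 - (2 * k) * (a θ * w θ) + k ^ 2 * a θ := by
      funext θ
      simp only [hu]
      ring
    rw [he, intervalIntegral.integral_add (i1.sub i2) i3, intervalIntegral.integral_sub i1 i2,
      intervalIntegral.integral_const_mul, intervalIntegral.integral_const_mul, hmean, ← hA]
    ring
  have hcongr : ∫ θ in (0:ℝ)..(2 * π), 1 / a θ * deriv w θ ^ 2 =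
      ∫ θ in (0:ℝ)..(2 * π), 1 / a θ * w' θ ^ 2 :=
    intervalIntegral.integral_congr_ae (hderiv.mono fun θ hθ _ => hθ)
  have hconst : 1 / (2 * π) * A = A / 2 / π := by
    field_simp
  rw [hconst, ← hcongr]
  have := mul_nonneg (sq_nonneg k) hA0
  linarith
end
end

section
/- Let B be the open unit disc in ℝ², let k : ℝ → ℝ be a 2π-periodic measurable function with 0 < m ≤ k(θ) ≤ M for all θ, and set ᾱ = 2π / ∫₀^{2π} k. Define A(x) = (1/k(arg x))·I + (k(arg x) − 1/k(arg x))·(x⊗x)/|x|² for x ∈ B \ {0}, and define u : B → ℝ in polar coordinates x = ρ e^{iθ} by u(x) = ρ^{ᾱ} · cos( ᾱ · ∫₀^{θ} k(s) ds ) (this is well defined since ᾱ∫₀^{θ+2π} k = ᾱ∫₀^{θ} k + 2π). Then u ∈ H¹(B) and u is a weak solution of div(A∇u) = 0 in B: ∫_B ⟨A(x)∇u(x), ∇φ(x)⟩ dx = 0 for every φ ∈ C_c^∞(B). -/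
open MeasureTheory Real Set Matrix

noncomputable section

/-- The polar angle `arg x` of a point `x` of the plane, so that
`x = |x| (cos (arg x), sin (arg x))`. -/
def polarAngle (x : EuclideanSpace ℝ (Fin 2)) : ℝ :=
  Complex.arg (x 0 + x 1 * Complex.I)

/-- The matrix `A(x) = (1/k(θ)) I + (k(θ) - 1/k(θ)) (x ⊗ x)/|x|²`, with `θ = arg x`. -/
def exMatrix (k : ℝ → ℝ) (x : EuclideanSpace ℝ (Fin 2)) : Matrix (Fin 2) (Fin 2) ℝ :=
  (1 / k (polarAngle x)) • (1 : Matrix (Fin 2) (Fin 2) ℝ) +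
    (k (polarAngle x) - 1 / k (polarAngle x)) • Matrix.of fun i j => x i * x j / ‖x‖ ^ 2

/-- Test functions: smooth compactly supported functions with support inside `Ω`. -/
def IsTestFun (Ω : Set (EuclideanSpace ℝ (Fin 2))) (φ : EuclideanSpace ℝ (Fin 2) → ℝ) : Prop :=
  ContDiff ℝ (⊤ : ℕ∞) φ ∧ HasCompactSupport φ ∧ tsupport φ ⊆ Ω

/-- The partial derivative `∂φ/∂xᵢ`. -/
def pd (φ : EuclideanSpace ℝ (Fin 2) → ℝ) (i : Fin 2) (x : EuclideanSpace ℝ (Fin 2)) : ℝ :=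
  fderiv ℝ φ x (EuclideanSpace.single i 1)

/-- `gu` is the weak gradient of `u` on `Ω`. -/
def HasWeakGradientOn (u : EuclideanSpace ℝ (Fin 2) → ℝ)
    (gu : EuclideanSpace ℝ (Fin 2) → EuclideanSpace ℝ (Fin 2))
    (Ω : Set (EuclideanSpace ℝ (Fin 2))) : Prop :=
  ∀ φ, IsTestFun Ω φ → ∀ i : Fin 2,
    ∫ x in Ω, u x * pd φ i x = - ∫ x in Ω, gu x i * φ x

/-- The point of the plane with polar coordinates `p = (ρ, θ)`. -/
def polarPoint (p : ℝ × ℝ) : EuclideanSpace ℝ (Fin 2) :=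
  !₂[p.1 * Real.cos p.2, p.1 * Real.sin p.2]

/-- The polar coordinates of the unit disc slit along the negative axis. -/
def polarRect : Set (ℝ × ℝ) := Ioo 0 1 ×ˢ Ioo (-π) π

/-- The components of the radial unit vector `e_r(θ)`. -/
def radialCoeff (i : Fin 2) (θ : ℝ) : ℝ := ![Real.cos θ, Real.sin θ] i

/-- The components of `-e_θ(θ)`, an antiderivative of `radialCoeff`. -/
def angularCoeff (i : Fin 2) (θ : ℝ) : ℝ := ![Real.sin θ, -Real.cos θ] i

/-- The function `ρ ^ α * g θ` in polar coordinates. -/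
def polarFun (α : ℝ) (g : ℝ → ℝ) (x : EuclideanSpace ℝ (Fin 2)) : ℝ :=
  ‖x‖ ^ α * g (polarAngle x)

/-- The gradient of `ρ ^ α * g θ`, where `g'` is the derivative of `g`. -/
def polarGrad (α : ℝ) (g g' : ℝ → ℝ) (x : EuclideanSpace ℝ (Fin 2)) : EuclideanSpace ℝ (Fin 2) :=
  WithLp.toLp 2 fun i => polarFun (α - 1)
    (fun θ => α * g θ * radialCoeff i θ - g' θ * angularCoeff i θ) x

lemma polarAngle_eq_arg (x : EuclideanSpace ℝ (Fin 2)) :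
    polarAngle x = Complex.arg ⟨x 0, x 1⟩ := by
  rw [polarAngle]; congr 1; apply Complex.ext <;> simp

lemma measurable_polarAngle : Measurable polarAngle := by
  unfold polarAngle
  exact Complex.measurable_arg.comp (by fun_prop)

lemma norm_polarPoint {p : ℝ × ℝ} (hp : 0 ≤ p.1) : ‖polarPoint p‖ = p.1 := by
  rw [EuclideanSpace.norm_eq, Fin.sum_univ_two]
  simp only [polarPoint, PiLp.toLp_apply, cons_val_zero, cons_val_one, Real.norm_eq_abs, sq_abs]
  rw [show (p.1 * Real.cos p.2) ^ 2 + (p.1 * Real.sin p.2) ^ 2 = p.1 ^ 2 by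
    linear_combination p.1 ^ 2 * Real.cos_sq_add_sin_sq p.2, Real.sqrt_sq hp]

lemma polarAngle_polarPoint {p : ℝ × ℝ} (hp : 0 < p.1) (hp' : p.2 ∈ Ioo (-π) π) :
    polarAngle (polarPoint p) = p.2 := by
  rw [← Complex.arg_mul_cos_add_sin_mul_I hp (Ioo_subset_Ioc_self hp'), polarAngle]
  congr 1
  simp only [polarPoint, PiLp.toLp_apply, cons_val_zero, cons_val_one]
  push_cast
  ring

lemma norm_eq_norm_complex (x : EuclideanSpace ℝ (Fin 2)) :
    ‖x‖ = ‖(⟨x 0, x 1⟩ : ℂ)‖ := by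
  rw [EuclideanSpace.norm_eq, Fin.sum_univ_two, Complex.norm_def, Complex.normSq_apply]
  simp only [Real.norm_eq_abs, sq_abs]
  ring_nf

lemma norm_mul_radialCoeff (x : EuclideanSpace ℝ (Fin 2)) (i : Fin 2) :
    ‖x‖ * radialCoeff i (polarAngle x) = x i := by
  rw [norm_eq_norm_complex, polarAngle_eq_arg]
  fin_cases i
  · simp [radialCoeff]
  · simp [radialCoeff]

lemma continuous_polarPoint : Continuous polarPoint := by
  unfold polarPoint
  fun_prop

lemma measurableSet_polarRect : MeasurableSet polarRect :=
  measurableSet_Ioo.prod measurableSet_Ioo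

lemma integral_eq_integral_polarPoint (f : EuclideanSpace ℝ (Fin 2) → ℝ) :
    ∫ x, f x = ∫ p in Ioi (0 : ℝ) ×ˢ Ioo (-π) π, p.1 * f (polarPoint p) := by
  rw [← (PiLp.volume_preserving_toLp (Fin 2)).integral_comp
    (MeasurableEquiv.toLp 2 _).measurableEmbedding,
    ← (volume_preserving_finTwoArrow ℝ).symm.integral_comp
      (MeasurableEquiv.finTwoArrow).symm.measurableEmbedding, ← integral_comp_polarCoord_symm]
  rfl

lemma setIntegral_ball_eq_polarRect (f : EuclideanSpace ℝ (Fin 2) → ℝ) :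
    ∫ x in Metric.ball 0 1, f x = ∫ p in polarRect, p.1 * f (polarPoint p) := by
  rw [← integral_indicator measurableSet_ball, integral_eq_integral_polarPoint,
    ← integral_indicator (measurableSet_Ioi.prod measurableSet_Ioo),
    ← integral_indicator measurableSet_polarRect]
  congr 1
  ext p
  by_cases h0 : 0 < p.1
  · simp only [Set.indicator, polarRect, mem_prod, mem_Ioi, mem_Ioo, Metric.mem_ball,
      dist_zero_right, norm_polarPoint h0.le, h0, true_and]
    grind
  · simp [Set.indicator, polarRect, h0]

lemma hasDerivAt_angularCoeff (i : Fin 2) (θ : ℝ) :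
    HasDerivAt (angularCoeff i) (radialCoeff i θ) θ := by
  unfold angularCoeff radialCoeff
  fin_cases i
  · simpa using Real.hasDerivAt_sin θ
  · simpa using (Real.hasDerivAt_cos θ).fun_neg

lemma continuous_radialCoeff (i : Fin 2) : Continuous (radialCoeff i) := by
  unfold radialCoeff
  fin_cases i
  · simpa using Real.continuous_cos
  · simpa using Real.continuous_sin

lemma contDiff_angularCoeff (i : Fin 2) : ContDiff ℝ 1 (angularCoeff i) := by
  unfold angularCoeff
  fin_cases i
  · simpa using Real.contDiff_sin
  · simpa using Real.contDiff_cos.neg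

lemma abs_radialCoeff_le (i : Fin 2) (θ : ℝ) : |radialCoeff i θ| ≤ 1 := by
  fin_cases i <;> simp [radialCoeff, Real.abs_cos_le_one, Real.abs_sin_le_one]

lemma abs_angularCoeff_le (i : Fin 2) (θ : ℝ) : |angularCoeff i θ| ≤ 1 := by
  fin_cases i <;> simp [angularCoeff, Real.abs_cos_le_one, Real.abs_sin_le_one]

lemma angularCoeff_neg_pi (i : Fin 2) : angularCoeff i (-π) = angularCoeff i π := by
  fin_cases i <;> simp [angularCoeff]

lemma measurable_polarFun (β : ℝ) {h : ℝ → ℝ} (hh : Measurable h) : Measurable (polarFun β h) :=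
  (by fun_prop : Measurable fun x : EuclideanSpace ℝ (Fin 2) => ‖x‖ ^ β).mul
    (hh.comp measurable_polarAngle)

lemma integrableOn_polarFun {β C : ℝ} (hβ : -2 < β) {h : ℝ → ℝ} (hh : Measurable h)
    (hC : ∀ θ, |h θ| ≤ C) : IntegrableOn (polarFun β h) (Metric.ball 0 1) := by
  have hloc : LocallyIntegrable (polarFun β h) := by
    refine locallyIntegrable_of_norm_le_rpow (α := -β) (C := C) (by simp) (by simp; linarith)
      (Filter.Eventually.of_forall fun x => ?_) (measurable_polarFun β hh).aestronglyMeasurable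
    rw [polarFun, Real.norm_eq_abs, abs_mul, neg_neg,
      abs_of_nonneg (Real.rpow_nonneg (norm_nonneg x) β), mul_comm]
    exact mul_le_mul_of_nonneg_right (hC _) (Real.rpow_nonneg (norm_nonneg x) β)
  exact (hloc.integrableOn_isCompact (isCompact_closedBall 0 1)).mono_set
    Metric.ball_subset_closedBall

lemma polarFun_sq (β : ℝ) (h : ℝ → ℝ) (x : EuclideanSpace ℝ (Fin 2)) :
    polarFun β h x ^ 2 = polarFun (β * 2) (fun θ => h θ ^ 2) x := by
  rw [polarFun, polarFun, mul_pow, Real.rpow_mul (norm_nonneg x), Real.rpow_two]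

lemma integrableOn_polarFun_sq {β C : ℝ} (hβ : -1 < β) {h : ℝ → ℝ} (hh : Measurable h)
    (hC : ∀ θ, |h θ| ≤ C) : IntegrableOn (fun x => polarFun β h x ^ 2) (Metric.ball 0 1) := by
  simp_rw [polarFun_sq]
  refine integrableOn_polarFun (C := C ^ 2) (by linarith) (hh.pow_const 2) fun θ => ?_
  rw [abs_pow]
  exact pow_le_pow_left₀ (abs_nonneg _) (hC θ) 2

lemma integrableOn_polarRect {a C : ℝ} (ha : 0 ≤ a) {h : ℝ → ℝ} (hh : Measurable h)
    (hC : ∀ θ, |h θ| ≤ C) {Ψ : ℝ × ℝ → ℝ} (hΨ : Continuous Ψ) :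
    IntegrableOn (fun p : ℝ × ℝ => p.1 ^ a * h p.2 * Ψ p) polarRect := by
  have hsub : polarRect ⊆ Icc 0 1 ×ˢ Icc (-π) π :=
    prod_mono Ioo_subset_Icc_self Ioo_subset_Icc_self
  have hinteg : IntegrableOn Ψ polarRect :=
    (hΨ.continuousOn.integrableOn_compact (isCompact_Icc.prod isCompact_Icc)).mono_set hsub
  refine Integrable.bdd_mul (c := C) hinteg (by fun_prop) ?_
  refine (ae_restrict_iff' measurableSet_polarRect).2 (Filter.Eventually.of_forall fun p hp => ?_)
  have hp1 := hp.1
  rw [Real.norm_eq_abs, abs_mul, abs_of_nonneg (Real.rpow_nonneg hp1.1.le a)]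
  calc p.1 ^ a * |h p.2| ≤ 1 * |h p.2| :=
        mul_le_mul_of_nonneg_right (Real.rpow_le_one hp1.1.le hp1.2.le ha) (abs_nonneg _)
    _ ≤ C := by rw [one_mul]; exact hC _

/-- The radial derivative `∂φ/∂ρ`. -/
def radialDeriv (φ : EuclideanSpace ℝ (Fin 2) → ℝ) (p : ℝ × ℝ) : ℝ :=
  fderiv ℝ φ (polarPoint p) (polarPoint (1, p.2))

/-- The angular derivative `∂φ/∂θ`. -/
def angularDeriv (φ : EuclideanSpace ℝ (Fin 2) → ℝ) (p : ℝ × ℝ) : ℝ :=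
  fderiv ℝ φ (polarPoint p) !₂[-(p.1 * Real.sin p.2), p.1 * Real.cos p.2]

section

variable {φ : EuclideanSpace ℝ (Fin 2) → ℝ}

lemma hasDerivAt_comp_polarPoint_fst (hφ : ContDiff ℝ 1 φ) (ρ θ : ℝ) :
    HasDerivAt (fun r => φ (polarPoint (r, θ))) (radialDeriv φ (ρ, θ)) ρ := by
  have hd : HasDerivAt (fun r : ℝ => polarPoint (r, θ)) (polarPoint (1, θ)) ρ := by
    have h : (fun r : ℝ => polarPoint (r, θ)) = fun r => r • polarPoint (1, θ) := by
      ext r j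
      fin_cases j <;> simp [polarPoint]
    rw [h]
    simpa using (hasDerivAt_id ρ).smul_const (polarPoint (1, θ))
  exact ((hφ.differentiable one_ne_zero (polarPoint (ρ, θ))).hasFDerivAt).comp_hasDerivAt ρ hd

lemma hasDerivAt_comp_polarPoint_snd (hφ : ContDiff ℝ 1 φ) (ρ θ : ℝ) :
    HasDerivAt (fun t => φ (polarPoint (ρ, t))) (angularDeriv φ (ρ, θ)) θ := by
  have hd : HasDerivAt (fun t : ℝ => polarPoint (ρ, t))
      !₂[-(ρ * Real.sin θ), ρ * Real.cos θ] θ := by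
    have h := ((hasDerivAt_pi (φ := fun t : ℝ => ![ρ * Real.cos t, ρ * Real.sin t])
      (φ' := ![-(ρ * Real.sin θ), ρ * Real.cos θ])).2 fun i => by
        fin_cases i
        · simpa using (Real.hasDerivAt_cos θ).const_mul ρ
        · simpa using (Real.hasDerivAt_sin θ).const_mul ρ)
    exact ((PiLp.continuousLinearEquiv 2 ℝ
      fun _ : Fin 2 => ℝ).symm.hasFDerivAt).comp_hasDerivAt θ h
  exact ((hφ.differentiable one_ne_zero (polarPoint (ρ, θ))).hasFDerivAt).comp_hasDerivAt θ hd

lemma continuous_radialDeriv (hφ : ContDiff ℝ 1 φ) : Continuous (radialDeriv φ) :=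
  ((hφ.continuous_fderiv one_ne_zero).comp continuous_polarPoint).clm_apply
    (continuous_polarPoint.comp (by fun_prop))

lemma continuous_angularDeriv (hφ : ContDiff ℝ 1 φ) : Continuous (angularDeriv φ) :=
  ((hφ.continuous_fderiv one_ne_zero).comp continuous_polarPoint).clm_apply (by fun_prop)

lemma mul_pd_polarPoint (φ : EuclideanSpace ℝ (Fin 2) → ℝ) (i : Fin 2) (p : ℝ × ℝ) :
    p.1 * pd φ i (polarPoint p) =
      p.1 * radialCoeff i p.2 * radialDeriv φ p - angularCoeff i p.2 * angularDeriv φ p := by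
  have h : p.1 • EuclideanSpace.single i (1 : ℝ) = (p.1 * radialCoeff i p.2) • polarPoint (1, p.2) -
      angularCoeff i p.2 • !₂[-(p.1 * Real.sin p.2), p.1 * Real.cos p.2] := by
    have hs := Real.sin_sq_add_cos_sq p.2
    ext j
    fin_cases i <;> fin_cases j <;> simp [radialCoeff, angularCoeff, polarPoint]
    · linear_combination -p.1 * hs
    · ring
    · ring
    · linear_combination -p.1 * hs
  have h' := congrArg (fderiv ℝ φ (polarPoint p)) h
  simp only [map_sub, map_smul, smul_eq_mul] at h'
  exact h'

lemma integral_radial_eq_zero (hφ : ContDiff ℝ 1 φ)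
    (h0 : ∀ x ∉ Metric.ball 0 1, φ x = 0) {α : ℝ} (hα : 0 < α) (θ : ℝ) :
    ∫ ρ in Ioo (0 : ℝ) 1, ((α + 1) * ρ ^ α * φ (polarPoint (ρ, θ)) +
      ρ ^ (α + 1) * radialDeriv φ (ρ, θ)) = 0 := by
  rw [← integral_Ioc_eq_integral_Ioo, ← intervalIntegral.integral_of_le zero_le_one]
  have hderiv : ∀ ρ ∈ uIcc (0 : ℝ) 1, HasDerivAt (fun r => r ^ (α + 1) * φ (polarPoint (r, θ)))
      ((α + 1) * ρ ^ α * φ (polarPoint (ρ, θ)) + ρ ^ (α + 1) * radialDeriv φ (ρ, θ)) ρ := by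
    intro ρ _
    have h := (Real.hasDerivAt_rpow_const (x := ρ) (p := α + 1) (Or.inr (by linarith))).fun_mul
      (hasDerivAt_comp_polarPoint_fst hφ ρ θ)
    simpa using h
  have hcont : Continuous fun ρ => (α + 1) * ρ ^ α * φ (polarPoint (ρ, θ)) +
      ρ ^ (α + 1) * radialDeriv φ (ρ, θ) := by
    have h1 : Continuous fun ρ : ℝ => ρ ^ α := Real.continuous_rpow_const hα.le
    have h2 : Continuous fun ρ : ℝ => ρ ^ (α + 1) := Real.continuous_rpow_const (by linarith)
    have h3 : Continuous fun ρ => φ (polarPoint (ρ, θ)) :=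
      hφ.continuous.comp (continuous_polarPoint.comp (by fun_prop))
    have h4 : Continuous fun ρ => radialDeriv φ (ρ, θ) :=
      (continuous_radialDeriv hφ).comp (by fun_prop)
    exact ((continuous_const.mul h1).mul h3).add (h2.mul h4)
  rw [intervalIntegral.integral_eq_sub_of_hasDerivAt hderiv (hcont.intervalIntegrable 0 1),
    h0 (polarPoint (1, θ)) (by simp [norm_polarPoint])]
  simp [Real.zero_rpow (by linarith : α + 1 ≠ 0)]

lemma integral_angular_eq_zero (hφ : ContDiff ℝ 1 φ) {g g' : ℝ → ℝ} {K : NNReal}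
    (hg : LipschitzWith K g) (hg' : ∀ᵐ θ, HasDerivAt g (g' θ) θ) (hper : g (-π) = g π)
    (i : Fin 2) (ρ : ℝ) :
    ∫ θ in Ioo (-π) π, (g' θ * angularCoeff i θ * φ (polarPoint (ρ, θ)) +
      g θ * radialCoeff i θ * φ (polarPoint (ρ, θ)) +
      g θ * angularCoeff i θ * angularDeriv φ (ρ, θ)) = 0 := by
  rw [← integral_Ioc_eq_integral_Ioo,
    ← intervalIntegral.integral_of_le (by linarith [Real.pi_pos])]
  have hpt : ContDiff ℝ 1 fun θ => polarPoint (ρ, θ) := by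
    refine contDiff_euclidean.2 fun j => ?_
    fin_cases j
    · simpa [polarPoint] using contDiff_const.mul Real.contDiff_cos
    · simpa [polarPoint] using contDiff_const.mul Real.contDiff_sin
  have hψ : ContDiff ℝ 1 fun θ => angularCoeff i θ * φ (polarPoint (ρ, θ)) :=
    (contDiff_angularCoeff i).mul (hφ.comp hpt)
  have hac : AbsolutelyContinuousOnInterval
      (fun θ => g θ * (angularCoeff i θ * φ (polarPoint (ρ, θ)))) (-π) π :=
    hg.lipschitzOnWith.absolutelyContinuousOnInterval.fun_mul
      hψ.contDiffOn.absolutelyContinuousOnInterval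
  have heq := hac.integral_deriv_eq_sub
  have hend : polarPoint (ρ, -π) = polarPoint (ρ, π) := by simp [polarPoint]
  rw [hper, angularCoeff_neg_pi, hend, sub_self] at heq
  rw [← heq]
  refine intervalIntegral.integral_congr_ae ?_
  filter_upwards [hg'] with θ hθ _
  rw [(hθ.fun_mul ((hasDerivAt_angularCoeff i θ).fun_mul
    (hasDerivAt_comp_polarPoint_snd hφ ρ θ))).deriv]
  ring

lemma integral_polarFun_mul_pd (hφ : ContDiff ℝ 1 φ)
    (h0 : ∀ x ∉ Metric.ball 0 1, φ x = 0) {α : ℝ} (hα : 0 < α) {g g' : ℝ → ℝ} {K : NNReal}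
    {C C' : ℝ} (hg : LipschitzWith K g) (hg' : ∀ᵐ θ, HasDerivAt g (g' θ) θ)
    (hper : g (-π) = g π) (hgm : Measurable g') (hC : ∀ θ, |g θ| ≤ C) (hC' : ∀ θ, |g' θ| ≤ C')
    (i : Fin 2) :
    ∫ x in Metric.ball 0 1, polarFun α g x * pd φ i x =
      -∫ x in Metric.ball 0 1, polarGrad α g g' x i * φ x := by
  have hcr := continuous_radialCoeff i
  have hca := (contDiff_angularCoeff i).continuous
  have hbound : ∀ {f c : ℝ → ℝ} {D : ℝ}, (∀ θ, |f θ| ≤ D) → (∀ θ, |c θ| ≤ 1) →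
      ∀ θ, |f θ * c θ| ≤ D := fun {f c D} hf hc θ => by
    rw [abs_mul]
    exact (mul_le_of_le_one_right (abs_nonneg _) (hc θ)).trans (hf θ)
  have hΦ : Continuous fun p => φ (polarPoint p) := hφ.continuous.comp continuous_polarPoint
  have i1 := integrableOn_polarRect hα.le (hg.continuous.measurable.mul hcr.measurable)
    (hbound hC (abs_radialCoeff_le i)) hΦ
  have i2 := integrableOn_polarRect (by linarith : 0 ≤ α + 1)
    (hg.continuous.measurable.mul hcr.measurable)
    (hbound hC (abs_radialCoeff_le i)) (continuous_radialDeriv hφ)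
  have i3 := integrableOn_polarRect hα.le (hgm.mul hca.measurable)
    (hbound hC' (abs_angularCoeff_le i)) hΦ
  have i4 := integrableOn_polarRect hα.le (hg.continuous.measurable.mul hca.measurable)
    (hbound hC (abs_angularCoeff_le i)) (continuous_angularDeriv hφ)
  simp only [Pi.mul_apply] at i1 i2 i3 i4
  have hP := (i1.const_mul (α + 1)).add i2
  have hQ := (Integrable.add i3 i1).add i4
  have hvol : (volume : Measure (ℝ × ℝ)).restrict polarRect =
      (volume.restrict (Ioo 0 1)).prod (volume.restrict (Ioo (-π) π)) := by
    rw [Measure.prod_restrict]; rfl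
  have hP0 := integral_prod_symm _ (hvol ▸ hP)
  have hQ0 := integral_prod _ (hvol ▸ hQ)
  have hP1 : ∀ θ, ∫ ρ in Ioo (0 : ℝ) 1,
      ((α + 1) * (ρ ^ α * (g θ * radialCoeff i θ) * φ (polarPoint (ρ, θ))) +
        ρ ^ (α + 1) * (g θ * radialCoeff i θ) * radialDeriv φ (ρ, θ)) = 0 := fun θ => by
    have h : g θ * radialCoeff i θ * _ = _ :=
      mul_eq_zero_of_right _ (integral_radial_eq_zero hφ h0 hα θ)
    rw [← integral_const_mul] at h
    refine Eq.trans ?_ h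
    congr 1
    ext ρ
    ring
  have hQ1 : ∀ ρ : ℝ, ∫ θ in Ioo (-π) π,
      (ρ ^ α * (g' θ * angularCoeff i θ) * φ (polarPoint (ρ, θ)) +
        ρ ^ α * (g θ * radialCoeff i θ) * φ (polarPoint (ρ, θ)) +
        ρ ^ α * (g θ * angularCoeff i θ) * angularDeriv φ (ρ, θ)) = 0 := fun ρ => by
    have h : ρ ^ α * _ = _ :=
      mul_eq_zero_of_right _ (integral_angular_eq_zero hφ hg hg' hper i ρ)
    rw [← integral_const_mul] at h
    refine Eq.trans ?_ h
    congr 1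
    ext θ
    ring
  simp only [Pi.add_apply, hP1, hQ1, integral_zero, ← hvol] at hP0 hQ0
  rw [setIntegral_ball_eq_polarRect, setIntegral_ball_eq_polarRect, eq_neg_iff_add_eq_zero]
  have hA : ∫ p in polarRect, p.1 * (polarFun α g (polarPoint p) * pd φ i (polarPoint p)) =
      ∫ p in polarRect, (p.1 ^ (α + 1) * (g p.2 * radialCoeff i p.2) * radialDeriv φ p -
        p.1 ^ α * (g p.2 * angularCoeff i p.2) * angularDeriv φ p) := by
    refine setIntegral_congr_fun measurableSet_polarRect fun p hp => ?_
    have hp0 : 0 < p.1 := hp.1.1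
    simp only [polarFun, norm_polarPoint hp0.le, polarAngle_polarPoint hp0 hp.2,
      Real.rpow_add_one hp0.ne']
    linear_combination (p.1 ^ α * g p.2) * mul_pd_polarPoint φ i p
  have hB : ∫ p in polarRect, p.1 * (polarGrad α g g' (polarPoint p) i * φ (polarPoint p)) =
      ∫ p in polarRect, (α * (p.1 ^ α * (g p.2 * radialCoeff i p.2) * φ (polarPoint p)) -
        p.1 ^ α * (g' p.2 * angularCoeff i p.2) * φ (polarPoint p)) := by
    refine setIntegral_congr_fun measurableSet_polarRect fun p hp => ?_
    have hp0 : 0 < p.1 := hp.1.1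
    have hpow : p.1 ^ α = p.1 ^ (α - 1) * p.1 := by
      rw [← Real.rpow_add_one hp0.ne', sub_add_cancel]
    simp only [polarGrad, polarFun, norm_polarPoint hp0.le, polarAngle_polarPoint hp0 hp.2,
      hpow]
    ring
  rw [hA, hB]
  refine (integral_add (Integrable.sub i2 i4) (Integrable.sub (i1.const_mul α) i3)).symm.trans ?_
  calc _ = (∫ p in polarRect, _) - ∫ p in polarRect, _ := by
        refine Eq.trans ?_ (integral_sub hP hQ)
        congr 1
        ext p
        simp only [Pi.sub_apply]
        ring
    _ = 0 := (congrArg₂ (· - ·) hP0 hQ0).trans (sub_zero 0)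

end

section

variable {φ : EuclideanSpace ℝ (Fin 2) → ℝ}

lemma IsTestFun.eq_zero {Ω : Set (EuclideanSpace ℝ (Fin 2))} (hφ : IsTestFun Ω φ) :
    ∀ x ∉ Ω, φ x = 0 :=
  fun _ hx => image_eq_zero_of_notMem_tsupport fun h => hx (hφ.2.2 h)

lemma IsTestFun.contDiff_one {Ω : Set (EuclideanSpace ℝ (Fin 2))} (hφ : IsTestFun Ω φ) :
    ContDiff ℝ 1 φ :=
  hφ.1.of_le (by exact_mod_cast le_top)

lemma IsTestFun.pd {Ω : Set (EuclideanSpace ℝ (Fin 2))} (hφ : IsTestFun Ω φ) (i : Fin 2) :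
    IsTestFun Ω (pd φ i) :=
  ⟨(hφ.1.fderiv_right (m := (⊤ : ℕ∞)) (by norm_cast)).clm_apply contDiff_const,
    hφ.2.1.fderiv_apply ℝ _, (tsupport_fderiv_apply_subset ℝ _).trans hφ.2.2⟩

lemma pd_pd (hφ : ContDiff ℝ 2 φ) (i j : Fin 2) (x : EuclideanSpace ℝ (Fin 2)) :
    pd (pd φ i) j x = fderiv ℝ (fderiv ℝ φ) x (.single j 1) (.single i 1) := by
  have hd : DifferentiableAt ℝ (fderiv ℝ φ) x :=
    (hφ.fderiv_right (m := 1) (by norm_num)).differentiable (by norm_num) x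
  have h := hd.hasFDerivAt.clm_apply (hasFDerivAt_const (EuclideanSpace.single i (1 : ℝ)) x)
  unfold pd
  rw [h.fderiv]
  simp

lemma pd_comm (hφ : ContDiff ℝ 2 φ) (i j : Fin 2) : pd (pd φ i) j = pd (pd φ j) i := by
  ext x
  rw [pd_pd hφ, pd_pd hφ]
  exact hφ.contDiffAt.isSymmSndFDerivAt (by simp) _ _

end

/-- If `v` is the stream function of `u`, then `A ∇u = (∂₂v, -∂₁v)`. -/
lemma sum_exMatrix_mul_polarGrad {k : ℝ → ℝ} {x : EuclideanSpace ℝ (Fin 2)} (hx : x ≠ 0)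
    (hk : k (polarAngle x) ≠ 0) (α : ℝ) (c s : ℝ → ℝ) (q : Fin 2 → ℝ) :
    ∑ i, ∑ j, exMatrix k x i j * polarGrad α c (fun θ => -(α * k θ * s θ)) x i * q j =
      polarGrad α s (fun θ => α * k θ * c θ) x 1 * q 0 -
        polarGrad α s (fun θ => α * k θ * c θ) x 0 * q 1 := by
  have hA : ∀ i j, x i * x j / ‖x‖ ^ 2 =
      radialCoeff i (polarAngle x) * radialCoeff j (polarAngle x) := fun i j => by
    rw [← norm_mul_radialCoeff x i, ← norm_mul_radialCoeff x j]
    field_simp [norm_ne_zero_iff.mpr hx]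
  simp only [Fin.sum_univ_two, exMatrix, polarGrad, polarFun, Matrix.add_apply,
    Matrix.smul_apply, Matrix.of_apply, hA, smul_eq_mul, Matrix.one_apply_eq,
    Matrix.one_apply_ne zero_ne_one, Matrix.one_apply_ne one_ne_zero, angularCoeff, radialCoeff,
    Matrix.cons_val_zero, Matrix.cons_val_one]
  have hsq := Real.cos_sq_add_sin_sq (polarAngle x)
  have hinv := one_div_mul_cancel hk
  generalize polarAngle x = θ at *
  generalize 1 / k θ = r at *
  linear_combination
    ‖x‖ ^ (α - 1) * α * s θ * (Real.sin θ * q 0 - Real.cos θ * q 1) * hinv +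
    (k θ - r) * ‖x‖ ^ (α - 1) * α * c θ * (Real.cos θ * q 0 + Real.sin θ * q 1) * hsq

section

variable {α C C' : ℝ} {g g' : ℝ → ℝ}

lemma measurable_polarGrad_coeff (hg : Measurable g) (hg' : Measurable g') (i : Fin 2) :
    Measurable fun θ => α * g θ * radialCoeff i θ - g' θ * angularCoeff i θ :=
  ((hg.const_mul α).mul (continuous_radialCoeff i).measurable).sub
    (hg'.mul (contDiff_angularCoeff i).continuous.measurable)

lemma abs_polarGrad_coeff_le (hα : 0 < α) (hC : ∀ θ, |g θ| ≤ C) (hC' : ∀ θ, |g' θ| ≤ C')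
    (i : Fin 2) (θ : ℝ) :
    |α * g θ * radialCoeff i θ - g' θ * angularCoeff i θ| ≤ α * C + C' := by
  refine (abs_sub _ _).trans (add_le_add ?_ ?_)
  · rw [abs_mul, abs_mul, abs_of_pos hα]
    exact (mul_le_of_le_one_right (by positivity) (abs_radialCoeff_le i θ)).trans
      (mul_le_mul_of_nonneg_left (hC θ) hα.le)
  · rw [abs_mul]
    exact (mul_le_of_le_one_right (abs_nonneg _) (abs_angularCoeff_le i θ)).trans (hC' θ)

lemma integrableOn_polarGrad_sq (hα : 0 < α) (hg : Measurable g) (hg' : Measurable g')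
    (hC : ∀ θ, |g θ| ≤ C) (hC' : ∀ θ, |g' θ| ≤ C') (i : Fin 2) :
    IntegrableOn (fun x => polarGrad α g g' x i ^ 2) (Metric.ball 0 1) :=
  integrableOn_polarFun_sq (by linarith) (measurable_polarGrad_coeff hg hg' i)
    (abs_polarGrad_coeff_le hα hC hC' i)

lemma integrableOn_polarGrad_mul (hα : 0 < α) (hg : Measurable g) (hg' : Measurable g')
    (hC : ∀ θ, |g θ| ≤ C) (hC' : ∀ θ, |g' θ| ≤ C') (i : Fin 2)
    {φ : EuclideanSpace ℝ (Fin 2) → ℝ} (hφ : Continuous φ) (hφc : HasCompactSupport φ) :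
    IntegrableOn (fun x => polarGrad α g g' x i * φ x) (Metric.ball 0 1) := by
  obtain ⟨D, hD⟩ := hφc.exists_bound_of_continuous hφ
  have h : IntegrableOn (fun x => polarGrad α g g' x i) (Metric.ball 0 1) :=
    integrableOn_polarFun (by linarith) (measurable_polarGrad_coeff hg hg' i)
      (abs_polarGrad_coeff_le hα hC hC' i)
  exact Integrable.mul_bdd h hφ.aestronglyMeasurable (Filter.Eventually.of_forall hD)

end

section

variable {k : ℝ → ℝ} {m M : ℝ}

lemma intervalIntegrable_of_bounds (hk : Measurable k) (hkM : ∀ θ, |k θ| ≤ M) (a b : ℝ) :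
    IntervalIntegrable k volume a b :=
  (intervalIntegrable_const (c := M)).mono_fun hk.aestronglyMeasurable
    (Filter.Eventually.of_forall fun θ => (hkM θ).trans (le_abs_self M))

lemma lipschitzWith_primitive (hk : Measurable k) (hkM : ∀ θ, |k θ| ≤ M) :
    LipschitzWith M.toNNReal fun θ => ∫ s in (0 : ℝ)..θ, k s := by
  have hM : 0 ≤ M := (abs_nonneg _).trans (hkM 0)
  refine LipschitzWith.of_dist_le_mul fun a b => ?_
  have hi := intervalIntegrable_of_bounds hk hkM
  rw [Real.dist_eq, Real.dist_eq, intervalIntegral.integral_interval_sub_left (hi _ _) (hi _ _),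
    Real.coe_toNNReal M hM]
  exact intervalIntegral.norm_integral_le_of_norm_le_const (f := k) fun θ _ => hkM θ

lemma ae_hasDerivAt_primitive (hk : Measurable k) (hkM : ∀ θ, |k θ| ≤ M) :
    ∀ᵐ θ, HasDerivAt (fun θ => ∫ s in (0 : ℝ)..θ, k s) (k θ) θ := by
  have hloc : LocallyIntegrable k := (locallyIntegrable_const M).mono hk.aestronglyMeasurable
    (Filter.Eventually.of_forall fun θ => (hkM θ).trans (le_abs_self M))
  filter_upwards [LocallyIntegrable.ae_hasDerivAt_integral hloc] with θ hθ using hθ 0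

end

/-- **The function `u(ρe^{iθ}) = ρ^ᾱ cos(ᾱ ∫₀^θ k)` is in `H¹(B)` and is a weak solution of
`div(A ∇u) = 0` on the unit disc `B`, where `A` is the unit-determinant example matrix.** -/
theorem example_is_weak_solution
    (k : ℝ → ℝ) (hkmeas : Measurable k) (hkper : Function.Periodic k (2 * π))
    (m M : ℝ) (hm : 0 < m) (hbd : ∀ θ : ℝ, m ≤ k θ ∧ k θ ≤ M)
    (αbar : ℝ) (hαbar : αbar = 2 * π / ∫ s in (0:ℝ)..(2 * π), k s)
    (u : EuclideanSpace ℝ (Fin 2) → ℝ)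
    (hudef : ∀ x : EuclideanSpace ℝ (Fin 2),
      u x = ‖x‖ ^ αbar * Real.cos (αbar * ∫ s in (0:ℝ)..(polarAngle x), k s)) :
    ∃ gu : EuclideanSpace ℝ (Fin 2) → EuclideanSpace ℝ (Fin 2),
      IntegrableOn (fun x => u x ^ 2) (Metric.ball 0 1) volume ∧
      (∀ i : Fin 2, IntegrableOn (fun x => gu x i ^ 2) (Metric.ball 0 1) volume) ∧
      HasWeakGradientOn u gu (Metric.ball 0 1) ∧
      ∀ φ, IsTestFun (Metric.ball 0 1) φ →
        ∫ x in Metric.ball (0 : EuclideanSpace ℝ (Fin 2)) 1,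
          ∑ i, ∑ j, exMatrix k x i j * gu x i * pd φ j x = 0 := by
  have hkpos : ∀ θ, 0 < k θ := fun θ => hm.trans_le (hbd θ).1
  have hkM : ∀ θ, |k θ| ≤ M := fun θ => (abs_of_pos (hkpos θ)).trans_le (hbd θ).2
  have hki := intervalIntegrable_of_bounds hkmeas hkM
  have hI : 0 < ∫ s in (0 : ℝ)..(2 * π), k s :=
    intervalIntegral.intervalIntegral_pos_of_pos (hki _ _) hkpos (by positivity)
  have hα : 0 < αbar := hαbar ▸ by positivity
  set Θ : ℝ → ℝ := fun θ => αbar * ∫ s in (0 : ℝ)..θ, k s with hΘ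
  have hΘper : Θ π = Θ (-π) + 2 * π := by
    have h1 : (∫ s in (-π)..π, k s) = ∫ s in (0 : ℝ)..(2 * π), k s := by
      have := hkper.intervalIntegral_add_eq (-π) 0
      rwa [zero_add, show -π + 2 * π = π by ring] at this
    have h2 : αbar * ∫ s in (0 : ℝ)..(2 * π), k s = 2 * π := by
      rw [hαbar, div_mul_cancel₀ _ hI.ne']
    have h3 := intervalIntegral.integral_interval_sub_left (hki 0 π) (hki 0 (-π))
    simp only [hΘ]
    linear_combination αbar * h3 + αbar * h1 + h2
  have hΘderiv : ∀ᵐ θ, HasDerivAt Θ (αbar * k θ) θ := by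
    filter_upwards [ae_hasDerivAt_primitive hkmeas hkM] with θ hθ using hθ.const_mul αbar
  have hΘlip : LipschitzWith (‖αbar‖₊ * M.toNNReal) Θ :=
    (lipschitzWith_smul αbar).comp (lipschitzWith_primitive hkmeas hkM)
  have hΘm : Measurable Θ := hΘlip.continuous.measurable
  set c : ℝ → ℝ := fun θ => Real.cos (Θ θ) with hc
  set s : ℝ → ℝ := fun θ => Real.sin (Θ θ) with hs
  set c' : ℝ → ℝ := fun θ => -(αbar * k θ * s θ) with hc'
  set s' : ℝ → ℝ := fun θ => αbar * k θ * c θ with hs'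
  have hcd : ∀ᵐ θ, HasDerivAt c (c' θ) θ := by
    filter_upwards [hΘderiv] with θ hθ
    convert hθ.cos using 1
    simp only [hc', hs]
    ring
  have hsd : ∀ᵐ θ, HasDerivAt s (s' θ) θ := by
    filter_upwards [hΘderiv] with θ hθ
    convert hθ.sin using 1
    simp only [hs', hc]
    ring
  have hclip : LipschitzWith _ c := Real.lipschitzWith_cos.comp hΘlip
  have hslip : LipschitzWith _ s := Real.lipschitzWith_sin.comp hΘlip
  have hcm : Measurable c := Real.measurable_cos.comp hΘm
  have hsm : Measurable s := Real.measurable_sin.comp hΘm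
  have hcm' : Measurable c' := ((hkmeas.const_mul αbar).mul hsm).neg
  have hsm' : Measurable s' := (hkmeas.const_mul αbar).mul hcm
  have hcper : c (-π) = c π := by simp only [hc, hΘper, Real.cos_add_two_pi]
  have hsper : s (-π) = s π := by simp only [hs, hΘper, Real.sin_add_two_pi]
  have hcb : ∀ θ, |c θ| ≤ 1 := fun θ => Real.abs_cos_le_one _
  have hsb : ∀ θ, |s θ| ≤ 1 := fun θ => Real.abs_sin_le_one _
  have hmul : ∀ {t : ℝ} θ, |t| ≤ 1 → |αbar * k θ * t| ≤ αbar * M := fun {t} θ ht => by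
    rw [abs_mul, abs_mul, abs_of_pos hα]
    exact (mul_le_of_le_one_right (by positivity) ht).trans
      (mul_le_mul_of_nonneg_left (hkM θ) hα.le)
  have hcb' : ∀ θ, |c' θ| ≤ αbar * M := fun θ => (abs_neg _).trans_le (hmul θ (hsb θ))
  have hsb' : ∀ θ, |s' θ| ≤ αbar * M := fun θ => hmul θ (hcb θ)
  obtain rfl : u = polarFun αbar c := funext hudef
  refine ⟨polarGrad αbar c c', integrableOn_polarFun_sq (by linarith) hcm hcb,
    integrableOn_polarGrad_sq hα hcm hcm' hcb hcb', fun φ hφ i =>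
      integral_polarFun_mul_pd hφ.contDiff_one hφ.eq_zero hα hclip hcd hcper hcm' hcb hcb' i,
    fun φ hφ => ?_⟩
  have hv := fun i j => integral_polarFun_mul_pd (hφ.pd j).contDiff_one (hφ.pd j).eq_zero hα
    hslip hsd hsper hsm' hsb hsb' i
  have hinteg := fun i j => integrableOn_polarGrad_mul hα hsm hsm' hsb hsb' i
    (hφ.pd j).1.continuous (hφ.pd j).2.1
  calc _ = ∫ x in Metric.ball 0 1, (polarGrad αbar s s' x 1 * pd φ 0 x -
        polarGrad αbar s s' x 0 * pd φ 1 x) := by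
        refine integral_congr_ae (ae_restrict_of_ae ?_)
        filter_upwards [compl_mem_ae_iff.mpr (measure_singleton 0)] with x hx
        exact sum_exMatrix_mul_polarGrad hx (hkpos _).ne' αbar c s fun j => pd φ j x
    _ = 0 := by
        rw [integral_sub (hinteg 1 0) (hinteg 0 1), ← neg_eq_iff_eq_neg.mpr (hv 1 0),
          ← neg_eq_iff_eq_neg.mpr (hv 0 1),
          pd_comm (by exact_mod_cast contDiff_infty.1 hφ.1 2) 0 1, sub_self]
end
end
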